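/- For all integers n ≥ 2 and 1 ≤ k ≤ n, the melting ice cream scoop graph IC_{n+1}^{(k)} — the labelled graph on {1,…,n+1} obtained from the complete graph K_{n+1} by deleting the k edges {1, n+1}, {2, n+1}, …, {k, n+1} — is appendable (e)-positive, and its reverse graph (IC_{n+1}^{(k)})^r is also appendable (e)-positive. -/

import Mathlib

open scoped Classical
noncomputable section

/-- Words of length `d` in the positive integers. -/
abbrev NCWord (d : ℕ) := Fin d → ℕ+

/-- `M_d`: coefficient functions of homogeneous degree-`d` series in
noncommuting variables. -/
abbrev Md (d : ℕ) := NCWord d → ℚ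

/-- `Y_G`, the chromatic symmetric function of a labelled graph in
noncommuting variables, as an element of `M_d`. -/
def YG {d : ℕ} (G : SimpleGraph (Fin d)) : Md d :=
  fun w => if ∀ j k : Fin d, G.Adj j k → w j ≠ w k then 1 else 0

/-- Set partitions of `{0, …, d-1}`. -/
abbrev SetPtn (d : ℕ) := Finpartition (Finset.univ : Finset (Fin d))

/-- `j` and `k` lie in a common block of `π`. -/
def sameBlock {d : ℕ} (π : SetPtn d) (j k : Fin d) : Prop :=
  ∃ B ∈ π.parts, j ∈ B ∧ k ∈ B

/-- The elementary symmetric function `e_π` in noncommuting variables. -/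
def eSP {d : ℕ} (π : SetPtn d) : Md d :=
  fun w => if ∀ j k : Fin d, j ≠ k → sameBlock π j k → w j ≠ w k then 1 else 0

/-- The block of `π` containing `a`. -/
def blockOf {d : ℕ} (π : SetPtn d) (a : Fin d) : Finset (Fin d) :=
  Finset.univ.filter fun k => sameBlock π a k

/-- The type of a set partition relative to the distinguished element `a`:
the multiset of sizes of the blocks not containing `a` (an integer partition),
together with the size of the block containing `a`. -/
def ptype {d : ℕ} (π : SetPtn d) (a : Fin d) : Multiset ℕ × ℕ :=
  ((π.parts.erase (blockOf π a)).val.map Finset.card, (blockOf π a).card)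

/-- `K_d`: the span of the differences `e_{π₁} - e_{π₂}` over pairs of set
partitions of equal type (relative to the distinguished element `a`). -/
def Ksub {d : ℕ} (a : Fin d) : Submodule ℚ (Md d) :=
  Submodule.span ℚ
    {f | ∃ π₁ π₂ : SetPtn d, ptype π₁ a = ptype π₂ a ∧ f = eSP π₁ - eSP π₂}

/-- `(e)`-positivity of a labelled graph, with distinguished vertex `a`:
`Y_G` is congruent modulo `K_d` to a nonnegative combination of `e_π`'s. -/
def IsEPosNCAt {d : ℕ} (G : SimpleGraph (Fin d)) (a : Fin d) : Prop :=
  ∃ (s : Finset (SetPtn d)) (c : SetPtn d → ℚ),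
    (∀ π, 0 ≤ c π) ∧ YG G - ∑ π ∈ s, c π • eSP π ∈ Ksub a

/-- Induction `↑ : M_d → M_{d+1}`. -/
def induct {d : ℕ} (f : Md d) : Md (d + 1) :=
  fun w => if w (Fin.last d) = w ⟨d - 1, by omega⟩
    then f (fun t => w t.castSucc) else 0

/-- Concatenation of labelled graphs: identify the last vertex of `G` with
the first vertex of `H`. -/
def concatG {p q : ℕ} (G : SimpleGraph (Fin p)) (H : SimpleGraph (Fin q)) :
    SimpleGraph (Fin (p + q - 1)) :=
  SimpleGraph.fromRel fun a b =>
    (∃ i j : Fin p, G.Adj i j ∧ (a : ℕ) = (i : ℕ) ∧ (b : ℕ) = (j : ℕ)) ∨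
    (∃ i j : Fin q, H.Adj i j ∧ (a : ℕ) = (i : ℕ) + (p - 1) ∧ (b : ℕ) = (j : ℕ) + (p - 1))

/-- The reverse graph `G^r`. -/
def revG {d : ℕ} (G : SimpleGraph (Fin d)) : SimpleGraph (Fin d) :=
  SimpleGraph.comap (fun i : Fin d => (⟨d - 1 - (i : ℕ), by have := i.isLt; omega⟩ : Fin d)) G

/-- A labelled graph: a simple graph on vertex set `{0, …, n-1}`, `n ≥ 1`. -/
structure LGraph where
  n : ℕ
  npos : 0 < n
  G : SimpleGraph (Fin n)

/-- The last vertex of a labelled graph. -/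
def LGraph.last (A : LGraph) : Fin A.n := ⟨A.n - 1, by have := A.npos; omega⟩

/-- A labelled graph is `(e)`-positive (at its last vertex). -/
def LGraph.EPosNC (A : LGraph) : Prop := IsEPosNCAt A.G A.last

/-- Concatenation, as an operation on labelled graphs. -/
def LGraph.concat (A B : LGraph) : LGraph :=
  ⟨A.n + B.n - 1, by have := A.npos; have := B.npos; omega, concatG A.G B.G⟩

/-- Reversal, as an operation on labelled graphs. -/
def LGraph.rev (A : LGraph) : LGraph := ⟨A.n, A.npos, revG A.G⟩

/-- Appendable `(e)`-positivity: `G + H` is `(e)`-positive for every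
`(e)`-positive labelled graph `G`. -/
def LGraph.Appendable (H : LGraph) : Prop :=
  ∀ A : LGraph, A.EPosNC → (A.concat H).EPosNC

/-- The chromatic symmetric polynomial of `G` in `n` commuting variables. -/
def cspoly {V : Type} [Fintype V] [DecidableEq V] (G : SimpleGraph V) (n : ℕ) :
    MvPolynomial (Fin n) ℚ :=
  ∑ κ ∈ Finset.univ.filter (fun κ : V → Fin n => ∀ u v : V, G.Adj u v → κ u ≠ κ v),
    ∏ v : V, MvPolynomial.X (κ v)

/-- `e`-positivity of a finite graph. -/
def EPos {V : Type} [Fintype V] [DecidableEq V] (G : SimpleGraph V) : Prop :=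
  ∃ c : Nat.Partition (Fintype.card V) → ℚ, (∀ p, 0 ≤ c p) ∧
    ∀ n : ℕ, cspoly G n =
      ∑ p : Nat.Partition (Fintype.card V),
        c p • (p.parts.map fun r => MvPolynomial.esymm (Fin n) ℚ r).prod

/-- Closed neighbourhood of a vertex, as a finset. -/
def closedNbhd {d : ℕ} (G : SimpleGraph (Fin d)) (i : Fin d) : Finset (Fin d) :=
  Finset.univ.filter fun k => k = i ∨ G.Adj i k

/-- `m_i`: the largest label in the closed neighbourhood of `i`. -/
def mIdx {d : ℕ} (G : SimpleGraph (Fin d)) (i : Fin d) : Fin d :=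
  (closedNbhd G i).max' ⟨i, by simp [closedNbhd]⟩

/-- `w_i`: the smallest label in the closed neighbourhood of `i`. -/
def wIdx {d : ℕ} (G : SimpleGraph (Fin d)) (i : Fin d) : Fin d :=
  (closedNbhd G i).min' ⟨i, by simp [closedNbhd]⟩

/-- Labelled unit interval graph. -/
def IsUnitInterval {d : ℕ} (G : SimpleGraph (Fin d)) : Prop :=
  ∀ i v w j : Fin d, i ≤ v → v < w → w ≤ j → G.Adj i j → G.Adj v w

/-- An acyclic orientation of a graph, as an asymmetric relation with
irreflexive transitive closure whose symmetrization matches adjacency. -/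
def IsAcyclicOrientation {V : Type} (G : SimpleGraph V) (r : V → V → Prop) : Prop :=
  (∀ a b, r a b → ¬ r b a) ∧
  (∀ a b, a ≠ b → ((r a b ∨ r b a) ↔ G.Adj a b)) ∧
  Irreflexive (Relation.TransGen r)

/-- The set of sinks of an orientation. -/
def sinkSet {V : Type} [Fintype V] (r : V → V → Prop) : Finset V :=
  Finset.univ.filter fun x => ∀ y, ¬ r x y

/-- The labelled path `P_d`. -/
def PathG (d : ℕ) : SimpleGraph (Fin d) :=
  SimpleGraph.fromRel fun a b => (b : ℕ) = (a : ℕ) + 1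

/-- The labelled cycle `C_d`. -/
def CycleG (d : ℕ) : SimpleGraph (Fin d) :=
  SimpleGraph.fromRel fun a b => (b : ℕ) = (a : ℕ) + 1 ∨ ((a : ℕ) = 0 ∧ (b : ℕ) = d - 1)

/-- The melting ice cream scoop graph `IC_{n+1}^{(k)}`: the complete graph on
`n+1` vertices with the edges between the last vertex and the first `k`
vertices deleted. -/
def ICgraph (n k : ℕ) : SimpleGraph (Fin (n + 1)) :=
  (⊤ : SimpleGraph (Fin (n + 1))).deleteEdges
    {e | ∃ t : Fin (n + 1), (t : ℕ) < k ∧ e = s(t, Fin.last n)}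

/-- The indicator of the words that are injective on `B`. -/
def injInd {d : ℕ} (B : Finset (Fin d)) : Md d :=
  fun w => if Set.InjOn w B then 1 else 0

/-- The indicator of the words with equal letters in positions `x` and `y`. -/
def eqInd {d : ℕ} (x y : Fin d) : Md d := fun w => if w x = w y then 1 else 0

/-- The indicator of the words that are constant on `U ∪ {v}`. -/
def constInd {d : ℕ} (v : Fin d) (U : Finset (Fin d)) : Md d :=
  fun w => if ∀ u ∈ U, w u = w v then 1 else 0

section Indicators

variable {d : ℕ}

lemma eqInd_comm (x y : Fin d) : eqInd x y = eqInd y x := by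
  funext w; simp only [eqInd, eq_comm]

lemma eqInd_self (x : Fin d) : eqInd x x = 1 := by
  funext w; simp [eqInd]

lemma injInd_empty : injInd (∅ : Finset (Fin d)) = 1 := by
  funext w; simp [injInd]

lemma injInd_insert {v : Fin d} {C : Finset (Fin d)} (hv : v ∉ C) :
    injInd (insert v C) = injInd C * (1 - ∑ s ∈ C, eqInd v s) := by
  funext w
  simp only [injInd, eqInd, Pi.mul_apply, Pi.sub_apply, Pi.one_apply, Finset.sum_apply,
    Finset.coe_insert, Set.injOn_insert (Finset.mem_coe.not.2 hv)]
  by_cases hC : Set.InjOn w C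
  · by_cases hw : ∃ s ∈ C, w s = w v
    · obtain ⟨s, hs, hsv⟩ := hw
      have h1 : (∑ t ∈ C, if w v = w t then (1 : ℚ) else 0) = 1 := by
        rw [Finset.sum_eq_single_of_mem s hs]
        · simp [hsv]
        · intro t ht hts
          rw [if_neg]
          intro h
          exact hts (hC ht hs (h.symm.trans hsv.symm))
      have h2 : w v ∈ w '' (C : Set (Fin d)) := ⟨s, hs, hsv⟩
      simp [h1, h2]
    · push Not at hw
      have h1 : (∑ t ∈ C, if w v = w t then (1 : ℚ) else 0) = 0 :=
        Finset.sum_eq_zero fun t ht => if_neg fun h => hw t ht h.symm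
      have h2 : w v ∉ w '' (C : Set (Fin d)) := by
        rintro ⟨s, hs, h⟩
        exact hw s hs h
      simp [h1, h2, hC]
  · simp [hC]

lemma injInd_mul_eqInd_of_mem {B : Finset (Fin d)} {x y : Fin d} (hx : x ∈ B) (hy : y ∈ B)
    (hxy : x ≠ y) : injInd B * eqInd x y = 0 := by
  funext w
  by_cases hB : Set.InjOn w B
  · have : w x ≠ w y := fun h => hxy (hB hx hy h)
    simp [eqInd, this]
  · simp [injInd, hB]

/-- A noncommutative Newton identity. -/
lemma injInd_insert_eq_sum {v : Fin d} {B : Finset (Fin d)} (hv : v ∉ B) :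
    injInd (insert v B) = ∑ U ∈ B.powerset,
      ((-1 : ℚ) ^ U.card * (U.card.factorial : ℚ)) • (constInd v U * injInd (B \ U)) := by
  funext w
  set K := B.filter fun u => w u = w v with hK
  have hKB : K ⊆ B := Finset.filter_subset _ _
  have hsum : (∑ U ∈ B.powerset, ((-1 : ℚ) ^ U.card * (U.card.factorial : ℚ)) •
      (constInd v U * injInd (B \ U))) w =
      ∑ U ∈ K.powerset, ((-1 : ℚ) ^ U.card * (U.card.factorial : ℚ)) * injInd (B \ U) w := by
    rw [Finset.sum_apply]
    symm
    apply Finset.sum_subset_zero_on_sdiff (Finset.powerset_mono.2 hKB)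
    · intro U hU
      simp only [Finset.mem_sdiff, Finset.mem_powerset] at hU
      have : ¬ ∀ u ∈ U, w u = w v := fun h =>
        hU.2 fun u hu => Finset.mem_filter.2 ⟨hU.1 hu, h u hu⟩
      simp [constInd, this]
    · intro U hU
      have : ∀ u ∈ U, w u = w v := fun u hu =>
        (Finset.mem_filter.1 (Finset.mem_powerset.1 hU hu)).2
      simp only [Pi.smul_apply, Pi.mul_apply, constInd, smul_eq_mul, if_pos this, one_mul]
  rw [hsum]
  by_cases hinj : Set.InjOn w ((B \ K : Finset (Fin d)) : Set (Fin d))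
  · have hterm : ∀ U ∈ K.powerset,
        ((-1 : ℚ) ^ U.card * (U.card.factorial : ℚ)) * injInd (B \ U) w =
        (fun m : ℕ => ((-1 : ℚ) ^ m * (m.factorial : ℚ)) *
          (if K.card - m ≤ 1 then (1 : ℚ) else 0)) U.card := by
      intro U hU
      rw [Finset.mem_powerset] at hU
      have hiff : Set.InjOn w ((B \ U : Finset (Fin d)) : Set (Fin d)) ↔ K.card - U.card ≤ 1 := by
        rw [← Finset.card_sdiff_of_subset hU, Finset.card_le_one]
        constructor
        · intro h x hx y hy
          simp only [Finset.mem_sdiff, hK, Finset.mem_filter] at hx hy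
          exact h (by simp [hx.1.1, hx.2]) (by simp [hy.1.1, hy.2]) (hx.1.2.trans hy.1.2.symm)
        · intro h x hx y hy hxy
          simp only [Finset.coe_sdiff, Set.mem_sdiff, Finset.mem_coe] at hx hy
          by_cases hxv : w x = w v
          · exact h x (by simp [hK, hx, hxv]) y (by simp [hK, hy, hxy ▸ hxv])
          · exact hinj (by simp [hK, hx, hxv]) (by simp [hK, hy, hxy ▸ hxv]) hxy
      simp only [injInd, hiff]
    rw [Finset.sum_congr rfl hterm, Finset.sum_powerset_apply_card (fun m : ℕ =>
      ((-1 : ℚ) ^ m * (m.factorial : ℚ)) * (if K.card - m ≤ 1 then (1 : ℚ) else 0))]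
    rcases hk : K.card with _ | k
    · have hK0 : K = ∅ := Finset.card_eq_zero.1 hk
      have h2 : w v ∉ w '' (B : Set (Fin d)) := by
        rintro ⟨s, hs, h⟩
        have : s ∈ K := Finset.mem_filter.2 ⟨hs, h⟩
        simp [hK0] at this
      have h3 : Set.InjOn w (B : Set (Fin d)) := by simpa [hK0] using hinj
      simp [injInd, Set.injOn_insert (Finset.mem_coe.not.2 hv), h2, h3]
    · have hpos : K.Nonempty := Finset.card_pos.1 (by omega)
      obtain ⟨s, hs⟩ := hpos
      obtain ⟨hsB, hsv⟩ := Finset.mem_filter.1 hs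
      have h2 : ¬ Set.InjOn w ((insert v B : Finset (Fin d)) : Set (Fin d)) := fun h =>
        hv (h (by simp [hsB]) (by simp) hsv ▸ hsB)
      rw [Finset.sum_range_succ, Finset.sum_range_succ, Finset.sum_eq_zero]
      · simp only [injInd, h2, if_false, Nat.choose_self, Nat.choose_succ_self_right,
          Nat.factorial_succ]
        simp
        ring
      · intro m hm
        rw [Finset.mem_range] at hm
        rw [if_neg (by omega)]
        simp
  · have h1 : ¬ Set.InjOn w ((insert v B : Finset (Fin d)) : Set (Fin d)) := fun h =>
      hinj (h.mono (by
        intro x hx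
        simp only [Finset.coe_sdiff, Set.mem_sdiff, Finset.mem_coe] at hx
        simp [hx.1]))
    rw [Finset.sum_eq_zero]
    · simp only [injInd, if_neg h1]
    · intro U hU
      have : ¬ Set.InjOn w ((B \ U : Finset (Fin d)) : Set (Fin d)) := fun h =>
        hinj (h.mono (by
          exact_mod_cast Finset.sdiff_subset_sdiff le_rfl (Finset.mem_powerset.1 hU)))
      simp only [injInd, if_neg this, mul_zero]

end Indicators

/-- `f` is some `e_π` for which all blocks with at least two elements lie in `U`. -/
def IsEProd {d : ℕ} (U : Finset (Fin d)) (f : Md d) : Prop :=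
  ∃ π : SetPtn d, f = eSP π ∧ ∀ x y, x ≠ y → sameBlock π x y → x ∈ U ∧ y ∈ U

/-- The span of all `e_π`. -/
def ESpan (d : ℕ) : Submodule ℚ (Md d) := Submodule.span ℚ (Set.range eSP)

section ESpanClosure

variable {d : ℕ}

lemma sameBlock_iff_mem_part (π : SetPtn d) (j k : Fin d) : sameBlock π j k ↔ k ∈ π.part j := by
  rw [Finpartition.mem_part_iff_exists]
  simp only [sameBlock, and_comm]

lemma exists_setPtn_sameBlock (s : Setoid (Fin d)) :
    ∃ π : SetPtn d, ∀ x y, sameBlock π x y ↔ s x y :=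
  ⟨Finpartition.ofSetoid s, fun x y => by
    rw [sameBlock_iff_mem_part, Finpartition.mem_part_ofSetoid_iff_rel]⟩

lemma sameBlock_refl (π : SetPtn d) (x : Fin d) : sameBlock π x x := by
  rw [sameBlock_iff_mem_part]; simp

lemma sameBlock_symm {π : SetPtn d} {x y : Fin d} (h : sameBlock π x y) : sameBlock π y x := by
  obtain ⟨B, hB, hx, hy⟩ := h
  exact ⟨B, hB, hy, hx⟩

lemma sameBlock_trans {π : SetPtn d} {x y z : Fin d} (h : sameBlock π x y)
    (h' : sameBlock π y z) : sameBlock π x z := by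
  obtain ⟨B, hB, hx, hy⟩ := h
  obtain ⟨C, hC, hy', hz⟩ := h'
  obtain rfl := π.eq_of_mem_parts hB hC hy hy'
  exact ⟨B, hB, hx, hz⟩

lemma isEProd_one : IsEProd (∅ : Finset (Fin d)) 1 := by
  obtain ⟨π, hπ⟩ := exists_setPtn_sameBlock (⊥ : Setoid (Fin d))
  refine ⟨π, ?_, fun x y hxy h => absurd ((hπ x y).1 h) hxy⟩
  funext w
  have : ∀ j k : Fin d, j ≠ k → sameBlock π j k → w j ≠ w k :=
    fun j k hjk h => absurd ((hπ j k).1 h) hjk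
  simp only [eSP, if_pos this, Pi.one_apply]

lemma IsEProd.mul_injInd {U B : Finset (Fin d)} {f : Md d} (hf : IsEProd U f)
    (hBU : Disjoint B U) : IsEProd (B ∪ U) (f * injInd B) := by
  obtain ⟨π, rfl, hπ⟩ := hf
  rw [Finset.disjoint_left] at hBU
  have key : ∀ {x y}, x ∈ B → sameBlock π x y → x = y := by
    intro x y hx h
    by_contra hxy
    exact hBU hx (hπ x y hxy h).1
  let s : Setoid (Fin d) :=
    { r := fun x y => sameBlock π x y ∨ (x ∈ B ∧ y ∈ B)
      iseqv :=
        { refl := fun x => Or.inl (sameBlock_refl π x)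
          symm := fun h => h.imp sameBlock_symm And.symm
          trans := by
            rintro x y z (h | h) (h' | h')
            · exact Or.inl (sameBlock_trans h h')
            · obtain rfl := key h'.1 (sameBlock_symm h)
              exact Or.inr h'
            · obtain rfl := key h.2 h'
              exact Or.inr h
            · exact Or.inr ⟨h.1, h'.2⟩ } }
  obtain ⟨τ, hτ⟩ := exists_setPtn_sameBlock s
  have hτ' : ∀ x y, sameBlock τ x y ↔ sameBlock π x y ∨ (x ∈ B ∧ y ∈ B) := hτ
  refine ⟨τ, ?_, ?_⟩
  · funext w
    have hiff : (∀ j k : Fin d, j ≠ k → sameBlock τ j k → w j ≠ w k) ↔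
        (∀ j k : Fin d, j ≠ k → sameBlock π j k → w j ≠ w k) ∧ Set.InjOn w B := by
      constructor
      · intro h
        refine ⟨fun j k hjk hs => h j k hjk ((hτ' j k).2 (Or.inl hs)), fun x hx y hy hxy => ?_⟩
        by_contra hne
        exact h x y hne ((hτ' x y).2 (Or.inr ⟨hx, hy⟩)) hxy
      · rintro ⟨h1, h2⟩ j k hjk hs
        rcases (hτ' j k).1 hs with hs | ⟨hj, hk⟩
        · exact h1 j k hjk hs
        · exact fun h => hjk (h2 hj hk h)
    simp only [Pi.mul_apply, eSP, injInd, hiff, ite_and]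
    split_ifs <;> simp
  · intro x y hxy h
    rcases (hτ' x y).1 h with h | h
    · have := hπ x y hxy h
      simp [this]
    · simp [h]

lemma IsEProd.mono {U V : Finset (Fin d)} {f : Md d} (hf : IsEProd U f) (h : U ⊆ V) :
    IsEProd V f := by
  obtain ⟨π, rfl, hπ⟩ := hf
  exact ⟨π, rfl, fun x y hxy hs => (hπ x y hxy hs).imp (@h _) (@h _)⟩

lemma IsEProd.mem_eSpan {U : Finset (Fin d)} {f : Md d} (hf : IsEProd U f) : f ∈ ESpan d := by
  obtain ⟨π, rfl, -⟩ := hf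
  exact Submodule.subset_span ⟨π, rfl⟩

lemma isEProd_mul_prod {ι : Type*} {s : Finset ι} {F : ι → Finset (Fin d)} {U : Finset (Fin d)}
    {f : Md d} (hf : IsEProd U f) (hF : (s : Set ι).PairwiseDisjoint F)
    (hU : ∀ i ∈ s, Disjoint (F i) U) :
    IsEProd (s.biUnion F ∪ U) (f * ∏ i ∈ s, injInd (F i)) := by
  induction s using Finset.induction_on with
  | empty => simpa using hf
  | insert i s hi ih =>
    have h1 := ih (hF.subset (by simp)) fun j hj => hU j (Finset.mem_insert_of_mem hj)
    have h2 : Disjoint (F i) (s.biUnion F ∪ U) := by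
      rw [Finset.disjoint_union_right, Finset.disjoint_biUnion_right]
      refine ⟨fun j hj => hF (by simp) (by simp [hj]) (by rintro rfl; exact hi hj),
        hU i (Finset.mem_insert_self _ _)⟩
    have h3 := h1.mul_injInd h2
    rw [Finset.prod_insert hi, mul_comm (injInd (F i)), ← mul_assoc, Finset.biUnion_insert,
      Finset.union_assoc]
    exact h3

lemma IsEProd.mul_constInd_mem_eSpan {U C : Finset (Fin d)} {v : Fin d} {f : Md d}
    (hf : IsEProd U f) (hv : v ∉ C) (hCU : Disjoint (insert v C) U) :
    f * constInd v C ∈ ESpan d := by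
  induction C using Finset.strongInduction generalizing U f with
  | H C ih =>
    have h0 : f * injInd (insert v C) ∈ ESpan d := (hf.mul_injInd hCU).mem_eSpan
    rw [injInd_insert_eq_sum hv, Finset.mul_sum, ← Finset.insert_erase (Finset.mem_powerset_self C),
      Finset.sum_insert (Finset.notMem_erase _ _)] at h0
    have hrest : ∑ V ∈ C.powerset.erase C, f * (((-1 : ℚ) ^ V.card * (V.card.factorial : ℚ)) •
        (constInd v V * injInd (C \ V))) ∈ ESpan d := by
      refine Submodule.sum_mem _ fun V hV => ?_
      rw [Finset.mem_erase, Finset.mem_powerset] at hV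
      rw [mul_smul_comm]
      refine Submodule.smul_mem _ _ ?_
      rw [mul_comm (constInd v V), ← mul_assoc]
      have hd1 : Disjoint (C \ V) U :=
        (hCU.mono_left (Finset.subset_insert _ _)).mono_left Finset.sdiff_subset
      have hd2 : Disjoint (insert v V) (C \ V ∪ U) := by
        rw [Finset.disjoint_union_right]
        refine ⟨?_, hCU.mono_left (Finset.insert_subset_insert _ hV.2)⟩
        rw [Finset.disjoint_insert_left]
        exact ⟨fun h => hv (Finset.mem_sdiff.1 h).1, Finset.disjoint_sdiff⟩
      exact ih V (Finset.ssubset_iff_subset_ne.2 ⟨hV.2, hV.1⟩) (hf.mul_injInd hd1)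
        (fun h => hv (hV.2 h)) hd2
    have h1 := (Submodule.add_mem_iff_left _ hrest).1 h0
    rw [Finset.sdiff_self, injInd_empty, mul_one, mul_smul_comm] at h1
    refine (Submodule.smul_mem_iff _ ?_).1 h1
    exact mul_ne_zero (pow_ne_zero _ (by norm_num)) (by exact_mod_cast Nat.factorial_ne_zero _)

lemma constInd_mul_constInd_mul_eqInd (x y : Fin d) (U V : Finset (Fin d)) :
    constInd x U * constInd y V * eqInd x y = constInd x (insert y (U ∪ V)) := by
  funext w
  simp only [constInd, eqInd, Pi.mul_apply, Finset.forall_mem_insert, Finset.forall_mem_union]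
  by_cases hxy : w x = w y
  · simp only [hxy, if_true, mul_one, true_and, ite_and]
    split_ifs <;> simp
  · simp [hxy, Ne.symm hxy]

lemma IsEProd.mul_injInd_mul_eqInd_mem_eSpan {U B C : Finset (Fin d)} {x y : Fin d} {f : Md d}
    (hf : IsEProd U f) (hx : x ∈ B) (hy : y ∈ C) (hBC : Disjoint B C) (hBU : Disjoint B U)
    (hCU : Disjoint C U) : f * injInd B * injInd C * eqInd x y ∈ ESpan d := by
  obtain ⟨B, hxB, rfl⟩ : ∃ B', x ∉ B' ∧ insert x B' = B :=
    ⟨B.erase x, Finset.notMem_erase _ _, Finset.insert_erase hx⟩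
  obtain ⟨C, hyC, rfl⟩ : ∃ C', y ∉ C' ∧ insert y C' = C :=
    ⟨C.erase y, Finset.notMem_erase _ _, Finset.insert_erase hy⟩
  rw [injInd_insert_eq_sum hxB, injInd_insert_eq_sum hyC, Finset.mul_sum _ _ f, Finset.sum_mul_sum,
    Finset.sum_mul]
  refine Submodule.sum_mem _ fun V hV => ?_
  rw [Finset.sum_mul]
  refine Submodule.sum_mem _ fun W hW => ?_
  rw [Finset.mem_powerset] at hV hW
  have e : ∀ c c' : ℚ, f * c • (constInd x V * injInd (B \ V)) *
      c' • (constInd y W * injInd (C \ W)) * eqInd x y =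
      (c * c') • (f * injInd (B \ V) * injInd (C \ W) * constInd x (insert y (V ∪ W))) := by
    intro c c'
    rw [← constInd_mul_constInd_mul_eqInd]
    simp only [mul_smul_comm, smul_mul_assoc, smul_smul]
    rw [mul_comm c']
    congr 1
    ring
  rw [e]
  refine Submodule.smul_mem _ _ ?_
  simp only [Finset.disjoint_left, Finset.mem_insert] at hBC hBU hCU
  have h1 : Disjoint (B \ V) U := by
    rw [Finset.disjoint_left]; grind
  have h2 : Disjoint (C \ W) (B \ V ∪ U) := by
    rw [Finset.disjoint_left]; grind
  refine ((hf.mul_injInd h1).mul_injInd h2).mul_constInd_mem_eSpan ?_ ?_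
  · grind
  · rw [Finset.disjoint_left]; grind

lemma eSP_eq_prod (π : SetPtn d) : eSP π = ∏ B ∈ π.parts, injInd B := by
  funext w
  rw [Finset.prod_apply]
  simp only [injInd, eSP, Finset.prod_boole]
  congr 1
  rw [eq_iff_iff]
  constructor
  · intro h B hB x hx y hy hxy
    by_contra hne
    exact h x y hne ⟨B, hB, hx, hy⟩ hxy
  · rintro h j k hjk ⟨B, hB, hj, hk⟩ hw
    exact hjk (h B hB hj hk hw)

lemma mul_eqInd_mem_eSpan {f : Md d} (hf : f ∈ ESpan d) (x y : Fin d) :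
    f * eqInd x y ∈ ESpan d := by
  induction hf using Submodule.span_induction with
  | zero => simp
  | add f g _ _ hf hg => rw [add_mul]; exact add_mem hf hg
  | smul c f _ hf => rw [smul_mul_assoc]; exact Submodule.smul_mem _ _ hf
  | mem f hf =>
    obtain ⟨π, rfl⟩ := hf
    rcases eq_or_ne x y with rfl | hxy
    · rw [eqInd_self, mul_one]
      exact Submodule.subset_span ⟨π, rfl⟩
    have hxm : π.part x ∈ π.parts := π.part_mem.2 (Finset.mem_univ _)
    have hym : π.part y ∈ π.parts := π.part_mem.2 (Finset.mem_univ _)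
    have hx : x ∈ π.part x := by simp
    have hy : y ∈ π.part y := by simp
    rw [eSP_eq_prod, ← Finset.mul_prod_erase _ _ hxm]
    by_cases hp : π.part x = π.part y
    · rw [mul_right_comm, injInd_mul_eqInd_of_mem hx (hp ▸ hy) hxy, zero_mul]
      exact zero_mem _
    · have hym' : π.part y ∈ π.parts.erase (π.part x) := Finset.mem_erase.2 ⟨Ne.symm hp, hym⟩
      rw [← Finset.mul_prod_erase _ _ hym']
      set Q := (π.parts.erase (π.part x)).erase (π.part y) with hQ
      have hQsub : ∀ B ∈ Q, B ∈ π.parts ∧ B ≠ π.part x ∧ B ≠ π.part y := by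
        intro B hB
        simp only [hQ, Finset.mem_erase] at hB
        exact ⟨hB.2.2, hB.2.1, hB.1⟩
      have hdis : ∀ B ∈ π.parts, ∀ C ∈ π.parts, B ≠ C → Disjoint B C :=
        fun B hB C hC h => π.disjoint hB hC h
      have hr : IsEProd (Q.biUnion id ∪ ∅) (1 * ∏ B ∈ Q, injInd (id B)) :=
        isEProd_mul_prod isEProd_one
          (fun B hB C hC h => hdis B (hQsub B hB).1 C (hQsub C hC).1 h) (by simp)
      rw [one_mul, Finset.union_empty] at hr
      have hd : ∀ C ∈ π.parts, (∀ B ∈ Q, B ≠ C) → Disjoint C (Q.biUnion id) := by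
        intro C hC h
        rw [Finset.disjoint_biUnion_right]
        exact fun B hB => hdis C hC B (hQsub B hB).1 (h B hB).symm
      have := hr.mul_injInd_mul_eqInd_mem_eSpan hx hy (hdis _ hxm _ hym hp)
        (hd _ hxm fun B hB => (hQsub B hB).2.1) (hd _ hym fun B hB => (hQsub B hB).2.2)
      simp only [id] at this
      convert this using 2
      ring

lemma mul_injInd_mem_eSpan {f : Md d} (hf : f ∈ ESpan d) (B : Finset (Fin d)) :
    f * injInd B ∈ ESpan d := by
  induction B using Finset.induction_on with
  | empty => rwa [injInd_empty, mul_one]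
  | insert v B hv ih =>
    rw [injInd_insert hv, ← mul_assoc, mul_sub, mul_one, Finset.mul_sum]
    exact sub_mem ih (Submodule.sum_mem _ fun s _ => mul_eqInd_mem_eSpan ih v s)

end ESpanClosure

/-- Precomposition of words with a map of positions. -/
def pull {p N : ℕ} (ι : Fin p → Fin N) : Md p →ₗ[ℚ] Md N :=
  LinearMap.funLeft ℚ ℚ fun w => w ∘ ι

section Pull

variable {p N : ℕ}

lemma pull_apply (ι : Fin p → Fin N) (f : Md p) (w : NCWord N) : pull ι f w = f (w ∘ ι) := rfl

lemma pull_mul (ι : Fin p → Fin N) (f g : Md p) : pull ι (f * g) = pull ι f * pull ι g := rfl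

lemma pull_prod (ι : Fin p → Fin N) {α : Type*} (s : Finset α) (F : α → Md p) :
    pull ι (∏ i ∈ s, F i) = ∏ i ∈ s, pull ι (F i) := by
  funext w
  simp only [pull_apply, Finset.prod_apply]

lemma pull_eqInd (ι : Fin p → Fin N) (x y : Fin p) : pull ι (eqInd x y) = eqInd (ι x) (ι y) := rfl

lemma pull_injInd (ι : Fin p ↪ Fin N) (B : Finset (Fin p)) :
    pull ι (injInd B) = injInd (B.map ι) := by
  funext w
  simp only [pull_apply, injInd, Finset.coe_map]
  congr 1
  rw [eq_iff_iff]
  exact ⟨fun h => h.image_of_comp, fun h => h.comp ι.injective.injOn (Set.mapsTo_image _ _)⟩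

end Pull

section Types

variable {d : ℕ}

lemma blockOf_eq_part (π : SetPtn d) (a : Fin d) : blockOf π a = π.part a := by
  ext x
  simp [blockOf, sameBlock_iff_mem_part]

lemma sameBlock_iff_part_eq (π : SetPtn d) (x y : Fin d) :
    sameBlock π x y ↔ π.part x = π.part y := by
  rw [sameBlock_iff_mem_part, Finpartition.mem_part_iff_part_eq_part _ (Finset.mem_univ _)
    (Finset.mem_univ _), eq_comm]

lemma eSP_eq_pull_of_sameBlock_iff {π₁ π₂ : SetPtn d} (σ : Equiv.Perm (Fin d))
    (h : ∀ x y, sameBlock π₁ x y ↔ sameBlock π₂ (σ x) (σ y)) : eSP π₂ = pull σ (eSP π₁) := by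
  funext w
  simp only [pull_apply, eSP, Function.comp_apply, h]
  congr 1
  rw [eq_iff_iff]
  constructor
  · intro hw j k hjk
    exact hw _ _ (σ.injective.ne hjk)
  · intro hw j k hjk hs
    have := hw (σ.symm j) (σ.symm k) (σ.symm.injective.ne hjk)
    simp only [Equiv.apply_symm_apply] at this
    exact this hs

/-- Relabelling a set partition by a permutation fixing `a` preserves its type. -/
lemma exists_ptype_eq_and_eSP_eq_pull (π : SetPtn d) {a : Fin d} (σ : Equiv.Perm (Fin d))
    (ha : σ a = a) : ∃ τ : SetPtn d, ptype τ a = ptype π a ∧ eSP τ = pull σ (eSP π) := by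
  let φ : Finset (Fin d) ↪ Finset (Fin d) := (Finset.mapEmbedding σ.toEmbedding).toEmbedding
  have hφ : ∀ B, φ B = B.map σ.toEmbedding := fun _ => rfl
  let τ : SetPtn d := Finpartition.ofExistsUnique (π.parts.map φ)
    (fun _ _ => Finset.subset_univ _)
    (by
      intro x _
      refine ⟨φ (π.part (σ.symm x)), ⟨?_, ?_⟩, ?_⟩
      · exact Finset.mem_map_of_mem _ (π.part_mem.2 (Finset.mem_univ _))
      · rw [hφ, Finset.mem_map_equiv]
        simp
      · rintro C ⟨hC, hx⟩
        obtain ⟨B, hB, rfl⟩ := Finset.mem_map.1 hC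
        rw [hφ, Finset.mem_map_equiv] at hx
        rw [π.part_eq_of_mem hB hx])
    (by
      rw [Finset.mem_map]
      rintro ⟨B, hB, h⟩
      exact π.ne_empty hB (Finset.map_eq_empty.1 h))
  have hparts : τ.parts = π.parts.map φ := rfl
  have hpart : τ.part a = φ (π.part a) := by
    refine τ.part_eq_of_mem ?_ ?_
    · rw [hparts]
      exact Finset.mem_map_of_mem _ (π.part_mem.2 (Finset.mem_univ _))
    · rw [hφ, Finset.mem_map]
      exact ⟨a, by simp, ha⟩
  refine ⟨τ, ?_, ?_⟩
  · simp only [ptype, blockOf_eq_part]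
    rw [hpart, hparts, ← Finset.map_erase, Finset.map_val, Multiset.map_map]
    simp [hφ]
  · refine eSP_eq_pull_of_sameBlock_iff σ fun x y => ?_
    simp only [sameBlock, hparts, Finset.mem_map, exists_exists_and_eq_and]
    simp [hφ]

/-- Set partitions of equal type differ by a permutation fixing `a`. -/
lemma exists_perm_eSP_eq_pull {π₁ π₂ : SetPtn d} {a : Fin d} (h : ptype π₁ a = ptype π₂ a) :
    ∃ σ : Equiv.Perm (Fin d), σ a = a ∧ eSP π₂ = pull σ (eSP π₁) := by
  simp only [ptype, blockOf_eq_part, Prod.mk.injEq] at h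
  obtain ⟨hmul, hcard⟩ := h
  let key : SetPtn d → Finset (Fin d) → Option ℕ := fun π B =>
    if B = π.part a then none else some B.card
  have hkey : ∀ c, (π₁.parts.filter fun B => key π₁ B = c).card =
      (π₂.parts.filter fun B => key π₂ B = c).card := by
    rintro (_ | c)
    · have : ∀ π : SetPtn d, (π.parts.filter fun B => key π B = none) = {π.part a} := by
        intro π
        ext B
        simp only [key, Finset.mem_filter, Finset.mem_singleton, ite_eq_left_iff, reduceCtorEq,
          imp_false, not_not]
        constructor
        · exact fun h => h.2
        · rintro rfl
          exact ⟨π.part_mem.2 (Finset.mem_univ _), rfl⟩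
      rw [this, this, Finset.card_singleton, Finset.card_singleton]
    · have : ∀ π : SetPtn d, (π.parts.filter fun B => key π B = some c).card =
          ((π.parts.erase (π.part a)).val.map Finset.card).count c := by
        intro π
        rw [Multiset.count_map, ← Finset.filter_val, Finset.card_val]
        congr 1
        ext B
        simp only [key, Finset.mem_filter, Finset.mem_erase]
        split_ifs with hB
        · simp [hB]
        · simp only [Option.some.injEq, hB, ne_eq, not_false_eq_true, true_and, eq_comm]
      rw [this, this, hmul]
  have hfib : ∀ c, Nonempty ({B : {B // B ∈ π₁.parts} // key π₁ B = c} ≃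
      {B : {B // B ∈ π₂.parts} // key π₂ B = c}) := by
    intro c
    rw [← Fintype.card_eq]
    have : ∀ π : SetPtn d, Fintype.card {B : {B // B ∈ π.parts} // key π B = c} =
        (π.parts.filter fun B => key π B = c).card := by
      intro π
      rw [Fintype.card_congr (Equiv.subtypeSubtypeEquivSubtypeInter (fun B => B ∈ π.parts)
        fun B => key π B = c)]
      exact Fintype.card_of_subtype _ (by simp)
    rw [this, this, hkey]
  let τ := Equiv.ofFiberEquiv fun c => (hfib c).some
  have hτ : ∀ B, key π₂ (τ B) = key π₁ B :=
    fun B => Equiv.ofFiberEquiv_map (fun c => (hfib c).some) B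
  have hpm : ∀ (π : SetPtn d) x, π.part x ∈ π.parts := fun π x => π.part_mem.2 (Finset.mem_univ _)
  have hτa : ∀ B : {B // B ∈ π₁.parts}, (B : Finset (Fin d)) = π₁.part a ↔ (τ B : Finset (Fin d)) = π₂.part a := by
    intro B
    have := hτ B
    simp only [key] at this
    split_ifs at this <;> simp_all
  have hτcard : ∀ B, (τ B : Finset (Fin d)).card = (B : Finset (Fin d)).card := by
    intro B
    by_cases hB : (B : Finset (Fin d)) = π₁.part a
    · rw [(hτa B).1 hB, hB, hcard]
    · have h' := hτ B
      simp only [key, if_neg hB, if_neg ((hτa B).not.1 hB)] at h'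
      exact Option.some.inj h'
  have hfib2 : ∀ C : {B // B ∈ π₂.parts}, Nonempty ({x // τ ⟨π₁.part x, hpm π₁ x⟩ = C} ≃
      {x // (⟨π₂.part x, hpm π₂ x⟩ : {B // B ∈ π₂.parts}) = C}) := by
    intro C
    rw [← Fintype.card_eq, Fintype.card_of_subtype (τ.symm C : Finset (Fin d)),
      Fintype.card_of_subtype (C : Finset (Fin d)), ← hτcard, Equiv.apply_symm_apply]
    · intro x
      rw [← π₂.part_eq_iff_mem C.2, Subtype.ext_iff]
    · intro x
      rw [← π₁.part_eq_iff_mem (τ.symm C).2, ← Equiv.eq_symm_apply, Subtype.ext_iff]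
  let σ₀ : Equiv.Perm (Fin d) := Equiv.ofFiberEquiv fun C => (hfib2 C).some
  have hσ₀ : ∀ x, π₂.part (σ₀ x) = τ ⟨π₁.part x, hpm π₁ x⟩ := fun x =>
    congrArg Subtype.val (Equiv.ofFiberEquiv_map (fun C => (hfib2 C).some) x)
  have ha : π₂.part (σ₀ a) = π₂.part a := by
    rw [hσ₀]
    exact (hτa _).1 rfl
  have hswap : ∀ z, π₂.part (Equiv.swap (σ₀ a) a z) = π₂.part z := by
    intro z
    rw [Equiv.swap_apply_def]
    split_ifs with h1 h2
    · rw [h1, ha]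
    · rw [h2, ha]
    · rfl
  refine ⟨σ₀.trans (Equiv.swap (σ₀ a) a), by simp, eSP_eq_pull_of_sameBlock_iff _ fun x y => ?_⟩
  simp only [sameBlock_iff_part_eq, Equiv.trans_apply, hswap, hσ₀]
  rw [← Subtype.ext_iff, τ.injective.eq_iff, Subtype.mk.injEq]

lemma sub_pull_mem_Ksub {f : Md d} (hf : f ∈ ESpan d) {a : Fin d} {σ : Equiv.Perm (Fin d)}
    (ha : σ a = a) : f - pull σ f ∈ Ksub a := by
  induction hf using Submodule.span_induction with
  | zero => simp
  | add f g _ _ hf hg =>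
    rw [map_add, add_sub_add_comm]
    exact add_mem hf hg
  | smul c f _ hf =>
    rw [map_smul, ← smul_sub]
    exact Submodule.smul_mem _ _ hf
  | mem f hf =>
    obtain ⟨π, rfl⟩ := hf
    obtain ⟨τ, h1, h2⟩ := exists_ptype_eq_and_eSP_eq_pull π σ ha
    exact Submodule.subset_span ⟨π, τ, h1.symm, by rw [h2]⟩

lemma IsEProd.pull_eq {U : Finset (Fin d)} {f : Md d} (hf : IsEProd U f)
    {σ : Equiv.Perm (Fin d)} (hσ : ∀ x ∈ U, σ x = x) : pull σ f = f := by
  obtain ⟨π, rfl, hπ⟩ := hf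
  refine (eSP_eq_pull_of_sameBlock_iff σ fun x y => ?_).symm
  rcases eq_or_ne x y with rfl | hxy
  · simp only [sameBlock_refl]
  · constructor
    · intro h
      obtain ⟨hx, hy⟩ := hπ x y hxy h
      rwa [hσ x hx, hσ y hy]
    · intro h
      obtain ⟨hx, hy⟩ := hπ _ _ (σ.injective.ne hxy) h
      rwa [σ.injective (hσ _ hx), σ.injective (hσ _ hy)] at h

end Types

/-- A class modulo `Ksub a` that is a nonnegative combination of classes of `e_π`'s. -/
def PosClass {d : ℕ} (a : Fin d) (x : Md d ⧸ Ksub a) : Prop :=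
  ∃ c : SetPtn d → ℚ, (∀ π, 0 ≤ c π) ∧ x = ∑ π, c π • (Ksub a).mkQ (eSP π)

section PosClass

variable {d : ℕ} {a : Fin d}

lemma PosClass.add {x y : Md d ⧸ Ksub a} (hx : PosClass a x) (hy : PosClass a y) :
    PosClass a (x + y) := by
  obtain ⟨c, hc, rfl⟩ := hx
  obtain ⟨c', hc', rfl⟩ := hy
  refine ⟨c + c', fun π => add_nonneg (hc π) (hc' π), ?_⟩
  simp only [Pi.add_apply, add_smul, Finset.sum_add_distrib]

lemma PosClass.smul {x : Md d ⧸ Ksub a} (hx : PosClass a x) {t : ℚ} (ht : 0 ≤ t) :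
    PosClass a (t • x) := by
  obtain ⟨c, hc, rfl⟩ := hx
  refine ⟨t • c, fun π => mul_nonneg ht (hc π), ?_⟩
  simp only [Pi.smul_apply, smul_assoc, Finset.smul_sum]

lemma PosClass.of_smul {x : Md d ⧸ Ksub a} {t : ℚ} (ht : 0 < t) (hx : PosClass a (t • x)) :
    PosClass a x := by
  have := hx.smul (inv_nonneg.2 ht.le)
  rwa [inv_smul_smul₀ ht.ne'] at this

lemma PosClass.sum {ι : Type*} {s : Finset ι} {F : ι → Md d ⧸ Ksub a}
    (h : ∀ i ∈ s, PosClass a (F i)) : PosClass a (∑ i ∈ s, F i) :=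
  Finset.sum_induction F (PosClass a) (fun _ _ => PosClass.add)
    ⟨0, fun _ => le_rfl, by simp⟩ h

lemma posClass_eSP (π : SetPtn d) : PosClass a ((Ksub a).mkQ (eSP π)) := by
  refine ⟨Pi.single π 1, fun τ => ?_, ?_⟩
  · by_cases h : τ = π
    · subst h; simp
    · simp [h]
  · rw [Finset.sum_eq_single π] <;> simp +contextual

lemma IsEProd.posClass {U : Finset (Fin d)} {f : Md d} (hf : IsEProd U f) :
    PosClass a ((Ksub a).mkQ f) := by
  obtain ⟨π, rfl, -⟩ := hf
  exact posClass_eSP π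

lemma Ksub_le_eSpan : Ksub a ≤ ESpan d := by
  refine Submodule.span_le.2 ?_
  rintro f ⟨π₁, π₂, -, rfl⟩
  exact sub_mem (Submodule.subset_span ⟨π₁, rfl⟩) (Submodule.subset_span ⟨π₂, rfl⟩)

lemma mem_eSpan_of_posClass {f : Md d} (hf : PosClass a ((Ksub a).mkQ f)) : f ∈ ESpan d := by
  obtain ⟨c, -, hc⟩ := hf
  have h : f - ∑ π, c π • eSP π ∈ Ksub a := by
    rw [← Submodule.ker_mkQ (Ksub a), LinearMap.mem_ker, map_sub, hc]
    simp
  have h2 : ∑ π, c π • eSP π ∈ ESpan d :=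
    Submodule.sum_mem _ fun π _ => Submodule.smul_mem _ _ (Submodule.subset_span ⟨π, rfl⟩)
  exact (Submodule.sub_mem_iff_left _ h2).1 (Ksub_le_eSpan h)

end PosClass

section Cliques

variable {d : ℕ}

lemma mul_injInd_insert (f : Md d) {y : Fin d} {X : Finset (Fin d)} (hy : y ∉ X) :
    f * injInd (insert y X) = f * injInd X - ∑ u ∈ X, f * injInd X * eqInd u y := by
  rw [injInd_insert hy, ← mul_assoc, mul_sub, mul_one, Finset.mul_sum]
  simp only [eqInd_comm]

lemma map_swap_eq_self {x y : Fin d} {X : Finset (Fin d)} (h : x ∈ X ↔ y ∈ X) :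
    X.map (Equiv.swap x y).toEmbedding = X := by
  ext z
  rw [Finset.mem_map_equiv, Equiv.symm_swap, Equiv.swap_apply_def]
  split_ifs with h1 h2
  · rw [h1, h]
  · rw [h2, h]
  · rfl

lemma injInd_insert_mul_eqInd {x a : Fin d} {B : Finset (Fin d)} (hx : x ∉ B) (ha : a ∉ B) :
    injInd (insert x B) * eqInd x a = injInd (insert a B) * eqInd x a := by
  rw [injInd_insert hx, injInd_insert ha]
  funext w
  by_cases h : w x = w a
  · simp [eqInd, h]
  · simp [eqInd, h]

variable {U : Finset (Fin d)} {r : Md d} {a : Fin d}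

/-- Classes modulo `Ksub a` are unchanged by a transposition that respects all blocks. -/
lemma mkQ_mul_eqInd_congr (hr : IsEProd U r) {X Y : Finset (Fin d)} {x x' y : Fin d}
    (hxU : x ∉ U) (hxU' : x' ∉ U) (hxa : x ≠ a) (hxa' : x' ≠ a) (hX : x ∈ X ↔ x' ∈ X)
    (hY : x ∈ Y ↔ x' ∈ Y) (hyx : y ≠ x) (hyx' : y ≠ x') :
    (Ksub a).mkQ (r * injInd X * injInd Y * eqInd x y) =
      (Ksub a).mkQ (r * injInd X * injInd Y * eqInd x' y) := by
  have hmem : r * injInd X * injInd Y * eqInd x y ∈ ESpan d :=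
    mul_eqInd_mem_eSpan (mul_injInd_mem_eSpan (mul_injInd_mem_eSpan hr.mem_eSpan X) Y) x y
  have hσ : Equiv.swap x x' a = a := Equiv.swap_apply_of_ne_of_ne hxa.symm hxa'.symm
  have hK := sub_pull_mem_Ksub hmem hσ
  have hrσ : pull (Equiv.swap x x') r = r := hr.pull_eq fun z hz =>
    Equiv.swap_apply_of_ne_of_ne (by rintro rfl; exact hxU hz) (by rintro rfl; exact hxU' hz)
  have hI : ∀ Z : Finset (Fin d), (x ∈ Z ↔ x' ∈ Z) →
      pull (Equiv.swap x x') (injInd Z) = injInd Z := by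
    intro Z hZ
    have := pull_injInd (Equiv.swap x x').toEmbedding Z
    rwa [map_swap_eq_self hZ] at this
  rw [pull_mul, pull_mul, pull_mul, hrσ, hI X hX, hI Y hY, pull_eqInd, Equiv.swap_apply_left,
    Equiv.swap_apply_of_ne_of_ne hyx hyx'] at hK
  rw [← sub_eq_zero, ← map_sub, Submodule.mkQ_apply, Submodule.Quotient.mk_eq_zero]
  exact hK

/-- `a`, `x`, `B`, `C`, `U` are pairwise disjoint. -/
def Separated (U : Finset (Fin d)) (a x : Fin d) (B C : Finset (Fin d)) : Prop :=
  a ∉ U ∧ x ∉ U ∧ x ≠ a ∧ (∀ y ∈ B, y ∉ U ∧ y ≠ a ∧ y ≠ x) ∧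
    ∀ y ∈ C, y ∉ U ∧ y ≠ a ∧ y ≠ x ∧ y ∉ B

lemma Separated.symm {x : Fin d} {B C : Finset (Fin d)} (h : Separated U a x B C) : Separated U a x C B := by
  unfold Separated at *; grind

lemma Separated.insert_erase {x y : Fin d} {B C : Finset (Fin d)} (h : Separated U a x B C) (hy : y ∈ C) :
    Separated U a y (insert x B) (C.erase y) := by
  unfold Separated at *; grind

lemma Separated.erase_insert {x t : Fin d} {B C : Finset (Fin d)} (h : Separated U a x B C) (ht : t ∈ B) :
    Separated U a t (B.erase t) (insert x C) := (h.symm.insert_erase ht).symm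

/-- The disjoint cliques `B` and `C ∪ {a}`. -/
def twoCliques (r : Md d) (a : Fin d) (B C : Finset (Fin d)) : Md d :=
  r * injInd B * injInd (insert a C)

/-- The cliques `B ∪ {x}` and `C ∪ {a}` with equal letters in positions `x` and `a`. -/
def mergedCliques (r : Md d) (a x : Fin d) (B C : Finset (Fin d)) : Md d :=
  r * injInd (insert x B) * injInd (insert a C) * eqInd x a

/-- The cliques `B ∪ {x}` and `C ∪ {a}` with `x` adjacent to all of `C`. -/
def joinedCliques (r : Md d) (a x : Fin d) (B C : Finset (Fin d)) : Md d :=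
  r * injInd (insert x B) * injInd (insert a C) * (1 - ∑ y ∈ C, eqInd x y)

lemma mergedCliques_comm {x : Fin d} {B C : Finset (Fin d)} (h : Separated U a x B C) :
    mergedCliques r a x B C = mergedCliques r a x C B := by
  have hB := injInd_insert_mul_eqInd (x := x) (a := a) (B := B) (by unfold Separated at h; grind)
    (by unfold Separated at h; grind)
  have hC := injInd_insert_mul_eqInd (x := x) (a := a) (B := C) (by unfold Separated at h; grind)
    (by unfold Separated at h; grind)
  unfold mergedCliques
  calc r * injInd (insert x B) * injInd (insert a C) * eqInd x a
      = r * injInd (insert a C) * (injInd (insert x B) * eqInd x a) := by ring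
    _ = r * injInd (insert a B) * (injInd (insert a C) * eqInd x a) := by rw [hB]; ring
    _ = _ := by rw [← hC]; ring

lemma joinedCliques_eq {x : Fin d} {B C : Finset (Fin d)} (h : Separated U a x B C) :
    joinedCliques r a x B C =
      r * injInd (insert x B) * injInd (insert x (insert a C)) + mergedCliques r a x B C := by
  have ha : a ∉ C := by unfold Separated at h; grind
  have hx : x ∉ insert a C := by unfold Separated at h; grind
  rw [injInd_insert hx, Finset.sum_insert ha, joinedCliques, mergedCliques]
  ring

lemma isEProd_twoCliques (hr : IsEProd U r) {B C : Finset (Fin d)} (hB : Disjoint B U)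
    (hC : Disjoint (insert a C) (B ∪ U)) :
    IsEProd (insert a C ∪ (B ∪ U)) (twoCliques r a B C) :=
  (hr.mul_injInd hB).mul_injInd hC

lemma Separated.posClass_twoCliques (hr : IsEProd U r) {x : Fin d} {B C : Finset (Fin d)}
    (h : Separated U a x B C) : PosClass a ((Ksub a).mkQ (twoCliques r a (insert x B) C)) := by
  refine (isEProd_twoCliques hr ?_ ?_).posClass <;>
  · unfold Separated at h
    rw [Finset.disjoint_left]
    grind

lemma Separated.posClass_twoCliques' (hr : IsEProd U r) {x : Fin d} {B C : Finset (Fin d)}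
    (h : Separated U a x B C) : PosClass a ((Ksub a).mkQ (twoCliques r a B (insert x C))) := by
  refine (isEProd_twoCliques hr ?_ ?_).posClass <;>
  · unfold Separated at h
    rw [Finset.disjoint_left]
    grind

lemma mkQ_mergedCliques_rec (hr : IsEProd U r) {x : Fin d} {B C : Finset (Fin d)}
    (h : Separated U a x B C) :
    ((B.card : ℚ) + 1) • (Ksub a).mkQ (mergedCliques r a x B C) =
      (Ksub a).mkQ (twoCliques r a (insert x B) C) - (Ksub a).mkQ (twoCliques r a C (insert x B)) +
        ∑ y ∈ C, (Ksub a).mkQ (mergedCliques r a y (insert x B) (C.erase y)) := by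
  have hxB : x ∉ B := by unfold Separated at h; grind
  have haX : a ∉ insert x B := by unfold Separated at h; grind
  have haC : a ∉ C := by unfold Separated at h; grind
  have h1 := congrArg (Ksub a).mkQ (mul_injInd_insert (r * injInd (insert a C)) haX)
  have h2 := congrArg (Ksub a).mkQ (mul_injInd_insert (r * injInd (insert a (insert x B))) haC)
  rw [map_sub, map_sum] at h1 h2
  have h3 : ∀ u ∈ insert x B, (Ksub a).mkQ (r * injInd (insert a C) * injInd (insert x B) *
      eqInd u a) = (Ksub a).mkQ (mergedCliques r a x B C) := by
    intro u hu
    rw [mkQ_mul_eqInd_congr hr (x' := x), mergedCliques, mul_right_comm r] <;>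
      · unfold Separated at h; grind
  have h4 : ∀ y ∈ C, (Ksub a).mkQ (r * injInd (insert a (insert x B)) * injInd C * eqInd y a) =
      (Ksub a).mkQ (mergedCliques r a y (insert x B) (C.erase y)) := by
    intro y hy
    rw [mergedCliques_comm (h.insert_erase hy), mergedCliques, Finset.insert_erase hy,
      mul_right_comm r]
  rw [Finset.sum_congr rfl h3, Finset.sum_const, Finset.card_insert_of_notMem hxB,
    ← Nat.cast_smul_eq_nsmul ℚ] at h1
  rw [Finset.sum_congr rfl h4] at h2
  rw [mul_right_comm r, h2] at h1
  push_cast at h1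
  rw [twoCliques, twoCliques, mul_right_comm r (injInd (insert x B)),
    mul_right_comm r (injInd C)]
  linear_combination (norm := module) h1

lemma mkQ_joinedCliques_rec_left (hr : IsEProd U r) {x : Fin d} {B C : Finset (Fin d)}
    (h : Separated U a x B C) :
    ((C.card : ℚ) + 1) • (Ksub a).mkQ (joinedCliques r a x B C) =
      ((C.card : ℚ) + 1 - B.card) • (Ksub a).mkQ (twoCliques r a B (insert x C)) +
        ∑ t ∈ B, (Ksub a).mkQ (joinedCliques r a t (B.erase t) (insert x C)) +
        ((C.card : ℚ) + 1) • (Ksub a).mkQ (mergedCliques r a x B C) := by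
  have hxB : x ∉ B := by unfold Separated at h; grind
  have hxC : x ∉ C := by unfold Separated at h; grind
  have h1 := congrArg (Ksub a).mkQ (mul_injInd_insert (r * injInd (insert a (insert x C))) hxB)
  rw [map_sub, map_sum] at h1
  have h2 : ∀ t ∈ B, (Ksub a).mkQ (joinedCliques r a t (B.erase t) (insert x C)) =
      (Ksub a).mkQ (twoCliques r a B (insert x C)) -
        ((C.card : ℚ) + 1) • (Ksub a).mkQ (r * injInd B * injInd (insert a (insert x C)) *
          eqInd t x) := by
    intro t ht
    have h3 : ∀ y ∈ insert x C, (Ksub a).mkQ (r * injInd B * injInd (insert a (insert x C)) *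
        eqInd t y) = (Ksub a).mkQ (r * injInd B * injInd (insert a (insert x C)) * eqInd t x) := by
      intro y hy
      rw [eqInd_comm t y, eqInd_comm t x]
      apply mkQ_mul_eqInd_congr hr <;>
      · unfold Separated at h; grind
    rw [joinedCliques, Finset.insert_erase ht, mul_sub, mul_one, Finset.mul_sum, map_sub, map_sum,
      Finset.sum_congr rfl h3, Finset.sum_const, Finset.card_insert_of_notMem hxC,
      ← Nat.cast_smul_eq_nsmul ℚ, twoCliques]
    push_cast
    rfl
  rw [Finset.sum_congr rfl h2, Finset.sum_sub_distrib, Finset.sum_const, ← Finset.smul_sum,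
    ← Nat.cast_smul_eq_nsmul ℚ, joinedCliques_eq h, map_add, Finset.insert_comm x a,
    mul_right_comm r (injInd (insert x B)), h1]
  simp only [twoCliques, mul_right_comm r (injInd (insert a (insert x C)))]
  module

lemma mkQ_joinedCliques_rec_right (hr : IsEProd U r) {x : Fin d} {B C : Finset (Fin d)}
    (h : Separated U a x B C) :
    ((B.card : ℚ) + 1) • (Ksub a).mkQ (joinedCliques r a x B C) =
      ((B.card : ℚ) + 1 - C.card) • (Ksub a).mkQ (twoCliques r a (insert x B) C) +
        ∑ y ∈ C, ((Ksub a).mkQ (joinedCliques r a y (insert x B) (C.erase y)) -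
          (Ksub a).mkQ (mergedCliques r a y (insert x B) (C.erase y))) := by
  have hxB : x ∉ B := by unfold Separated at h; grind
  have h2 : ∀ y ∈ C, (Ksub a).mkQ (joinedCliques r a y (insert x B) (C.erase y)) -
        (Ksub a).mkQ (mergedCliques r a y (insert x B) (C.erase y)) =
      (Ksub a).mkQ (twoCliques r a (insert x B) C) -
        ((B.card : ℚ) + 1) • (Ksub a).mkQ (r * injInd (insert x B) * injInd (insert a C) *
          eqInd x y) := by
    intro y hy
    have hyX : y ∉ insert x B := by unfold Separated at h; grind
    have h3 : ∀ u ∈ insert x B, (Ksub a).mkQ (r * injInd (insert a C) * injInd (insert x B) *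
        eqInd u y) = (Ksub a).mkQ (r * injInd (insert x B) * injInd (insert a C) * eqInd x y) := by
      intro u hu
      rw [mul_right_comm r]
      apply mkQ_mul_eqInd_congr hr <;>
      · unfold Separated at h; grind
    rw [joinedCliques_eq (h.insert_erase hy), map_add, add_sub_cancel_right, Finset.insert_comm y a,
      Finset.insert_erase hy, mul_right_comm r, mul_injInd_insert _ hyX, map_sub, map_sum,
      Finset.sum_congr rfl h3, Finset.sum_const, Finset.card_insert_of_notMem hxB,
      ← Nat.cast_smul_eq_nsmul ℚ, twoCliques, mul_right_comm r]
    push_cast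
    rfl
  rw [Finset.sum_congr rfl h2, Finset.sum_sub_distrib, Finset.sum_const, ← Finset.smul_sum,
    ← Nat.cast_smul_eq_nsmul ℚ, joinedCliques, mul_sub, mul_one, Finset.mul_sum, map_sub, map_sum]
  simp only [twoCliques]
  module

end Cliques

section Positivity

variable {d : ℕ} {U : Finset (Fin d)} {r : Md d} {a : Fin d}

lemma posClass_joinedCliques_add (hr : IsEProd U r) {B : Finset (Fin d)} :
    ∀ {x : Fin d} {C : Finset (Fin d)} {j : ℕ}, Separated U a x B C → j + B.card ≤ C.card →
      PosClass a ((Ksub a).mkQ (joinedCliques r a x B C) +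
        (j : ℚ) • (Ksub a).mkQ (mergedCliques r a x B C)) := by
  induction B using Finset.strongInduction with
  | H B ih =>
    intro x C j h hj
    have hxC : x ∉ C := by unfold Separated at h; grind
    have hterm : ∀ t ∈ B, PosClass a ((Ksub a).mkQ (joinedCliques r a t (B.erase t) (insert x C)) +
        ((j + 1 : ℕ) : ℚ) • (Ksub a).mkQ (mergedCliques r a t (insert x C) (B.erase t))) := by
      intro t ht
      rw [← mergedCliques_comm (h.erase_insert ht)]
      refine ih _ (Finset.erase_ssubset ht) (h.erase_insert ht) ?_
      have := Finset.card_pos.2 ⟨t, ht⟩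
      rw [Finset.card_erase_of_mem ht, Finset.card_insert_of_notMem hxC]
      omega
    have hq : (j : ℚ) + B.card ≤ C.card := by exact_mod_cast hj
    have hpos := (((h.posClass_twoCliques' hr).smul
      (t := (C.card : ℚ) - B.card - j) (by linarith)).add
      ((h.symm.posClass_twoCliques hr).smul (t := (j : ℚ) + 1) (by positivity))).add
      (PosClass.sum hterm)
    have h1 := mkQ_joinedCliques_rec_left hr h
    have h2 := mkQ_mergedCliques_rec hr h.symm
    rw [← mergedCliques_comm h] at h2
    refine PosClass.of_smul (t := (C.card : ℚ) + 1) (by positivity) ?_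
    convert hpos using 1
    rw [Finset.sum_add_distrib, ← Finset.smul_sum]
    push_cast
    linear_combination (norm := module) h1 + ((j : ℚ) + 1) • h2

lemma posClass_joinedCliques_sub (hr : IsEProd U r) {C : Finset (Fin d)} :
    ∀ {x : Fin d} {B : Finset (Fin d)} {j : ℕ}, Separated U a x B C → j + C.card ≤ B.card + 1 →
      PosClass a ((Ksub a).mkQ (joinedCliques r a x B C) -
        (j : ℚ) • (Ksub a).mkQ (mergedCliques r a x B C)) := by
  induction C using Finset.strongInduction with
  | H C ih =>
    intro x B j h hj
    have hxB : x ∉ B := by unfold Separated at h; grind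
    have hterm : ∀ y ∈ C, PosClass a ((Ksub a).mkQ (joinedCliques r a y (insert x B) (C.erase y)) -
        ((j + 1 : ℕ) : ℚ) • (Ksub a).mkQ (mergedCliques r a y (insert x B) (C.erase y))) := by
      intro y hy
      refine ih _ (Finset.erase_ssubset hy) (h.insert_erase hy) ?_
      have := Finset.card_pos.2 ⟨y, hy⟩
      rw [Finset.card_erase_of_mem hy, Finset.card_insert_of_notMem hxB]
      omega
    have hq : (j : ℚ) + C.card ≤ B.card + 1 := by exact_mod_cast hj
    have hpos := (((h.posClass_twoCliques hr).smul
      (t := (B.card : ℚ) + 1 - C.card - j) (by linarith)).add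
      ((h.symm.posClass_twoCliques' hr).smul (t := (j : ℚ)) (by positivity))).add
      (PosClass.sum hterm)
    have h1 := mkQ_joinedCliques_rec_right hr h
    have h2 := mkQ_mergedCliques_rec hr h
    rw [Finset.sum_sub_distrib] at h1
    refine PosClass.of_smul (t := (B.card : ℚ) + 1) (by positivity) ?_
    convert hpos using 1
    rw [Finset.sum_sub_distrib, ← Finset.smul_sum]
    push_cast
    linear_combination (norm := module) h1 - (j : ℚ) • h2

lemma posClass_joinedCliques (hr : IsEProd U r) {x : Fin d} {B C : Finset (Fin d)}
    (h : Separated U a x B C) : PosClass a ((Ksub a).mkQ (joinedCliques r a x B C)) := by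
  rcases le_total B.card C.card with hle | hle
  · simpa using posClass_joinedCliques_add hr (j := 0) h (by omega)
  · simpa using posClass_joinedCliques_sub hr (j := 0) h (by omega)

lemma posClass_sharedCliques_of_le (hr : IsEProd U r) {C : Finset (Fin d)} :
    ∀ {v : Fin d} {B : Finset (Fin d)}, Separated U a v B C → C.card ≤ B.card + 1 →
      PosClass a ((Ksub a).mkQ (r * injInd (insert v B) * injInd (insert v C))) := by
  induction C using Finset.strongInduction with
  | H C ih =>
    intro v B h hle
    have hvB : v ∉ B := by unfold Separated at h; grind
    have hvC : v ∉ C := by unfold Separated at h; grind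
    have hterm : ∀ s ∈ C, PosClass a ((Ksub a).mkQ
        (r * injInd (insert s (insert v B)) * injInd C)) := by
      intro s hs
      have hpos := ih _ (Finset.erase_ssubset hs) (h.insert_erase hs) (by
        have := Finset.card_pos.2 ⟨s, hs⟩
        rw [Finset.card_erase_of_mem hs, Finset.card_insert_of_notMem hvB]
        omega)
      rwa [Finset.insert_erase hs] at hpos
    have hbase : PosClass a ((Ksub a).mkQ (r * injInd (insert v B) * injInd C)) := by
      refine ((hr.mul_injInd (B := insert v B) ?_).mul_injInd (B := C) ?_).posClass <;>
      · unfold Separated at h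
        rw [Finset.disjoint_left]
        grind
    have hq : (C.card : ℚ) ≤ B.card + 1 := by exact_mod_cast hle
    have hexp : ∀ s ∈ C, (Ksub a).mkQ (r * injInd (insert s (insert v B)) * injInd C) =
        (Ksub a).mkQ (r * injInd (insert v B) * injInd C) - ((B.card : ℚ) + 1) •
          (Ksub a).mkQ (r * injInd (insert v B) * injInd C * eqInd s v) := by
      intro s hs
      have hsX : s ∉ insert v B := by unfold Separated at h; grind
      have h3 : ∀ u ∈ insert v B, (Ksub a).mkQ (r * injInd C * injInd (insert v B) *
          eqInd u s) = (Ksub a).mkQ (r * injInd (insert v B) * injInd C * eqInd s v) := by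
        intro u hu
        rw [mul_right_comm r, eqInd_comm s v]
        apply mkQ_mul_eqInd_congr hr <;>
        · unfold Separated at h; grind
      rw [mul_right_comm r, mul_injInd_insert _ hsX, map_sub, map_sum, Finset.sum_congr rfl h3,
        Finset.sum_const, Finset.card_insert_of_notMem hvB, ← Nat.cast_smul_eq_nsmul ℚ,
        mul_right_comm r]
      push_cast
      rfl
    have hpos := (hbase.smul (t := (B.card : ℚ) + 1 - C.card) (by linarith)).add
      (PosClass.sum hterm)
    refine PosClass.of_smul (t := (B.card : ℚ) + 1) (by positivity) ?_
    convert hpos using 1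
    rw [Finset.sum_congr rfl hexp, Finset.sum_sub_distrib, Finset.sum_const, ← Finset.smul_sum,
      ← Nat.cast_smul_eq_nsmul ℚ, mul_injInd_insert _ hvC, map_sub, map_sum]
    module

lemma posClass_sharedCliques (hr : IsEProd U r) {v : Fin d} {B C : Finset (Fin d)}
    (h : Separated U a v B C) :
    PosClass a ((Ksub a).mkQ (r * injInd (insert v B) * injInd (insert v C))) := by
  rcases le_total B.card C.card with hle | hle
  · rw [mul_right_comm]
    exact posClass_sharedCliques_of_le hr h.symm (by omega)
  · exact posClass_sharedCliques_of_le hr h (by omega)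

/-- Interpolation: removing a subset `S` of equivalent terms indexed by `C` is a convex
combination of removing none of them and removing all of them. -/
lemma posClass_of_subset {S C : Finset (Fin d)} (hSC : S ⊆ C) (hC : C.Nonempty) {f : Md d}
    {g : Fin d → Md d} (hg : ∀ s ∈ C, ∀ t ∈ C, (Ksub a).mkQ (g s) = (Ksub a).mkQ (g t))
    (h0 : PosClass a ((Ksub a).mkQ f))
    (h1 : PosClass a ((Ksub a).mkQ (f - ∑ s ∈ C, g s))) :
    PosClass a ((Ksub a).mkQ (f - ∑ s ∈ S, g s)) := by
  obtain ⟨t, ht⟩ := hC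
  have hcard : (0 : ℚ) < C.card := by exact_mod_cast Finset.card_pos.2 ⟨t, ht⟩
  have hle : (S.card : ℚ) ≤ C.card := by exact_mod_cast Finset.card_le_card hSC
  refine PosClass.of_smul hcard ?_
  convert (h0.smul (t := (C.card : ℚ) - S.card) (by linarith)).add
    (h1.smul (t := (S.card : ℚ)) (by positivity)) using 1
  rw [map_sub, map_sub, map_sum, map_sum, Finset.sum_congr rfl fun s hs => hg s hs t ht,
    Finset.sum_congr rfl fun s hs => hg s (hSC hs) t ht, Finset.sum_const, Finset.sum_const,
    ← Nat.cast_smul_eq_nsmul ℚ, ← Nat.cast_smul_eq_nsmul ℚ]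
  module

lemma posClass_append_reverse (hr : IsEProd U r) {x : Fin d} {B C S : Finset (Fin d)}
    (h : Separated U a x B C) (hSC : S ⊆ C) (hC : C.Nonempty) :
    PosClass a ((Ksub a).mkQ
      (r * injInd (insert x B) * (injInd (insert a C) * (1 - ∑ s ∈ S, eqInd x s)))) := by
  have key : ∀ T : Finset (Fin d),
      r * injInd (insert x B) * (injInd (insert a C) * (1 - ∑ s ∈ T, eqInd x s)) =
        twoCliques r a (insert x B) C -
          ∑ s ∈ T, r * injInd (insert x B) * injInd (insert a C) * eqInd x s := by
    intro T
    rw [← Finset.mul_sum, twoCliques]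
    ring
  rw [key]
  refine posClass_of_subset hSC hC ?_ (h.posClass_twoCliques hr) ?_
  · intro s hs t ht
    rw [eqInd_comm x s, eqInd_comm x t]
    apply mkQ_mul_eqInd_congr hr <;>
    · unfold Separated at h; grind
  · rw [← key, ← mul_assoc]
    exact posClass_joinedCliques hr h

lemma posClass_append_iceCream (hr : IsEProd U r) {v : Fin d} {B C S : Finset (Fin d)}
    (h : Separated U a v B C) (hSC : S ⊆ C) (hC : C.Nonempty) :
    PosClass a ((Ksub a).mkQ
      (r * injInd (insert v B) * (injInd (insert v C) * (1 - ∑ s ∈ S, eqInd a s)))) := by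
  have key : ∀ T : Finset (Fin d),
      r * injInd (insert v B) * (injInd (insert v C) * (1 - ∑ s ∈ T, eqInd a s)) =
        r * injInd (insert v B) * injInd (insert v C) -
          ∑ s ∈ T, r * injInd (insert v B) * injInd (insert v C) * eqInd a s := by
    intro T
    rw [← Finset.mul_sum]
    ring
  have hvC : v ∉ C := by unfold Separated at h; grind
  have haC : a ∉ C := by unfold Separated at h; grind
  rw [key]
  refine posClass_of_subset hSC hC ?_ (posClass_sharedCliques hr h) ?_
  · intro s hs t ht
    rw [eqInd_comm a s, eqInd_comm a t]
    apply mkQ_mul_eqInd_congr hr <;>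
    · unfold Separated at h; grind
  · have : r * injInd (insert v B) * (injInd (insert v C) * (1 - ∑ s ∈ C, eqInd a s)) =
        joinedCliques r a v B C := by
      rw [joinedCliques, injInd_insert hvC, injInd_insert haC]
      ring
    rw [← key, this]
    exact posClass_joinedCliques hr h

end Positivity

section Append

variable {p q : ℕ}

/-- The vertices of the first graph inside a concatenation. -/
def leftEmb (hq : 0 < q) : Fin p ↪ Fin (p + q - 1) :=
  Fin.castLEEmb (by omega)

/-- The vertices of the second graph inside a concatenation. -/
def rightEmb (hp : 0 < p) : Fin q ↪ Fin (p + q - 1) :=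
  ⟨fun j => ⟨j + (p - 1), by omega⟩, fun i j h => by
    simp only [Fin.mk.injEq] at h
    exact Fin.ext (by omega)⟩

lemma val_leftEmb (hq : 0 < q) (i : Fin p) : (leftEmb hq i : ℕ) = i := rfl

lemma val_rightEmb (hp : 0 < p) (j : Fin q) : (rightEmb hp j : ℕ) = j + (p - 1) := rfl

lemma YG_concatG (hp : 0 < p) (hq : 0 < q) (G : SimpleGraph (Fin p)) (H : SimpleGraph (Fin q)) :
    YG (concatG G H) = pull (leftEmb hq) (YG G) * pull (rightEmb hp) (YG H) := by
  funext w
  simp only [Pi.mul_apply, pull_apply, YG, Function.comp_apply]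
  rw [ite_zero_mul_ite_zero, mul_one]
  congr 1
  rw [eq_iff_iff]
  constructor
  · intro h
    refine ⟨fun i j hij => h _ _ ?_, fun i j hij => h _ _ ?_⟩
    · refine ⟨(leftEmb hq).injective.ne hij.ne, Or.inl (Or.inl ⟨i, j, hij, rfl, rfl⟩)⟩
    · refine ⟨(rightEmb hp).injective.ne hij.ne, Or.inl (Or.inr ⟨i, j, hij, rfl, rfl⟩)⟩
  · rintro ⟨h1, h2⟩ x y ⟨-, (⟨i, j, hij, hx, hy⟩ | ⟨i, j, hij, hx, hy⟩) |
      (⟨i, j, hij, hx, hy⟩ | ⟨i, j, hij, hx, hy⟩)⟩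
    · obtain rfl : x = leftEmb hq i := Fin.ext hx
      obtain rfl : y = leftEmb hq j := Fin.ext hy
      exact h1 i j hij
    · obtain rfl : x = rightEmb hp i := Fin.ext hx
      obtain rfl : y = rightEmb hp j := Fin.ext hy
      exact h2 i j hij
    · obtain rfl : y = leftEmb hq i := Fin.ext hx
      obtain rfl : x = leftEmb hq j := Fin.ext hy
      exact (h1 i j hij).symm
    · obtain rfl : y = rightEmb hp i := Fin.ext hx
      obtain rfl : x = rightEmb hp j := Fin.ext hy
      exact (h2 i j hij).symm

/-- The part of `π` containing `v` can be split off from the pullback of `e_π`. -/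
lemma exists_pull_eSP_eq {N : ℕ} (ι : Fin p ↪ Fin N) (π : SetPtn p) (v : Fin p) :
    ∃ (U B : Finset (Fin N)) (r : Md N), IsEProd U r ∧ Disjoint U (insert (ι v) B) ∧ ι v ∉ B ∧
      (∀ x ∈ U ∪ B, ∃ i, i ≠ v ∧ x = ι i) ∧ pull ι (eSP π) = r * injInd (insert (ι v) B) := by
  have hv : v ∈ π.part v := by simp
  have hpart : π.part v ∈ π.parts := by simp
  have hins : insert (ι v) (((π.part v).erase v).map ι) = (π.part v).map ι := by
    rw [← Finset.map_insert, Finset.insert_erase hv]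
  have hdisj : ∀ B ∈ π.parts.erase (π.part v), Disjoint B (π.part v) := fun B hB =>
    π.disjoint (Finset.mem_of_mem_erase hB) hpart (Finset.ne_of_mem_erase hB)
  have hE := isEProd_mul_prod (s := π.parts.erase (π.part v)) (F := fun B => B.map ι) isEProd_one
    (fun B hB C hC hBC => (Finset.disjoint_map ι).2 (π.disjoint
      (Finset.mem_of_mem_erase hB) (Finset.mem_of_mem_erase hC) hBC))
    (fun _ _ => Finset.disjoint_empty_right _)
  refine ⟨_, ((π.part v).erase v).map ι, _, hE, ?_, by simp, ?_, ?_⟩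
  · rw [hins, Finset.union_empty, Finset.disjoint_biUnion_left]
    exact fun B hB => (Finset.disjoint_map ι).2 (hdisj B hB)
  · intro x hx
    simp only [Finset.union_empty, Finset.mem_union, Finset.mem_biUnion, Finset.mem_map] at hx
    rcases hx with ⟨B, hB, i, hi, rfl⟩ | ⟨i, hi, rfl⟩
    · refine ⟨i, ?_, rfl⟩
      rintro rfl
      exact Finset.disjoint_left.1 (hdisj B hB) hi hv
    · exact ⟨i, Finset.ne_of_mem_erase hi, rfl⟩
  · rw [hins, one_mul, eSP_eq_prod, pull_prod, ← Finset.prod_erase_mul _ _ hpart]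
    simp only [pull_injInd]

lemma isEPosNCAt_iff_posClass {d : ℕ} (G : SimpleGraph (Fin d)) (a : Fin d) :
    IsEPosNCAt G a ↔ PosClass a ((Ksub a).mkQ (YG G)) := by
  have key : ∀ (s : Finset (SetPtn d)) (c : SetPtn d → ℚ),
      YG G - ∑ π ∈ s, c π • eSP π ∈ Ksub a ↔
        (Ksub a).mkQ (YG G) = ∑ π ∈ s, c π • (Ksub a).mkQ (eSP π) := by
    intro s c
    rw [← sub_eq_zero (a := (Ksub a).mkQ (YG G))]
    simp only [← map_smul, ← map_sum, ← map_sub]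
    rw [Submodule.mkQ_apply, Submodule.Quotient.mk_eq_zero]
  constructor
  · rintro ⟨s, c, hc, h⟩
    rw [(key s c).1 h]
    exact PosClass.sum fun π _ => (posClass_eSP π).smul (hc π)
  · rintro ⟨c, hc, h⟩
    exact ⟨Finset.univ, c, hc, (key _ c).2 h⟩

/-- A linear map preserving classes of equal type and sending each `e_π` to a positive class
sends positive classes to positive classes. -/
lemma PosClass.map {N : ℕ} {v : Fin p} {a : Fin N} (T : Md p →ₗ[ℚ] Md N)
    (hT : ∀ f ∈ Ksub v, T f ∈ Ksub a) (hpos : ∀ π, PosClass a ((Ksub a).mkQ (T (eSP π))))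
    {f : Md p} (hf : PosClass v ((Ksub v).mkQ f)) : PosClass a ((Ksub a).mkQ (T f)) := by
  obtain ⟨c, hc, h⟩ := hf
  have hf' : f - ∑ π, c π • eSP π ∈ Ksub v := by
    rw [← Submodule.ker_mkQ (Ksub v), LinearMap.mem_ker, map_sub, h]
    simp
  have h2 := hT _ hf'
  rw [← Submodule.ker_mkQ (Ksub a), LinearMap.mem_ker, map_sub, map_sub, sub_eq_zero] at h2
  rw [h2]
  simp only [map_sum, map_smul]
  exact PosClass.sum fun π _ => (hpos π).smul (hc π)

/-- Multiplying pullbacks by a series in letters that only meet `ι` at `v` preserves `Ksub`. -/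
lemma pull_mul_mem_Ksub {N m : ℕ} {v : Fin p} {a : Fin N} (ι : Fin p ↪ Fin N)
    (κ : Fin m → Fin N) (hκ : ∀ j i, κ j = ι i → i = v) (ha : a ∈ Set.range κ) (h : Md m)
    (hspan : ∀ π : SetPtn p, pull ι (eSP π) * pull κ h ∈ ESpan N) {f : Md p}
    (hf : f ∈ Ksub v) : pull ι f * pull κ h ∈ Ksub a := by
  induction hf using Submodule.span_induction with
  | zero => simp
  | add f g _ _ hf hg => rw [map_add, add_mul]; exact add_mem hf hg
  | smul c f _ hf => rw [map_smul, smul_mul_assoc]; exact Submodule.smul_mem _ _ hf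
  | mem f hf =>
    obtain ⟨π₁, π₂, htype, rfl⟩ := hf
    obtain ⟨σ, hσ, hπ⟩ := exists_perm_eSP_eq_pull htype
    have hσι : ∀ i, σ.viaEmbedding ι (ι i) = ι (σ i) := fun i =>
      Equiv.Perm.viaEmbedding_apply σ ι i
    have hσκ : ∀ j, σ.viaEmbedding ι (κ j) = κ j := by
      intro j
      by_cases hj : κ j ∈ Set.range ι
      · obtain ⟨i, hi⟩ := hj
        obtain rfl := hκ j i hi.symm
        rw [← hi, hσι, hσ]
      · exact Equiv.Perm.viaEmbedding_apply_of_notMem σ ι _ hj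
    have hfix : σ.viaEmbedding ι a = a := by
      obtain ⟨j, rfl⟩ := ha
      exact hσκ j
    have hK := sub_pull_mem_Ksub (hspan π₁) hfix
    have hpull : pull (σ.viaEmbedding ι) (pull ι (eSP π₁) * pull κ h) =
        pull ι (eSP π₂) * pull κ h := by
      rw [hπ]
      funext w
      simp only [pull_apply, Pi.mul_apply, Function.comp_assoc]
      congr 3 <;> funext i <;> simp [hσι, hσκ]
    rwa [hpull, ← sub_mul, ← map_sub] at hK

/-- It suffices to check appendability on disjoint cliques, one of which contains the vertex
shared with the appended graph. -/
lemma LGraph.appendable_of_posClass (H : LGraph)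
    (hpos : ∀ (p : ℕ) (hp : 0 < p) (a v : Fin (p + H.n - 1)) (U B : Finset (Fin (p + H.n - 1)))
      (r : Md (p + H.n - 1)), (a : ℕ) = p + H.n - 2 → (v : ℕ) = p - 1 → IsEProd U r →
      Disjoint U (insert v B) → v ∉ B → (∀ x ∈ U ∪ B, (x : ℕ) < p - 1) →
      PosClass a ((Ksub a).mkQ (r * injInd (insert v B) * pull (rightEmb hp) (YG H.G)))) :
    H.Appendable := by
  intro A hA
  have hp := A.npos
  have hq := H.npos
  have hpos' : ∀ π : SetPtn A.n, PosClass (A.concat H).last ((Ksub (A.concat H).last).mkQ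
      (pull (leftEmb hq) (eSP π) * pull (rightEmb hp) (YG H.G))) := by
    intro π
    obtain ⟨U, B, r, hr, hU, hB, hlt, heq⟩ := exists_pull_eSP_eq (leftEmb hq) π A.last
    rw [heq]
    refine hpos A.n hp _ _ U B r ?_ rfl hr hU hB fun x hx => ?_
    · simp only [LGraph.last, LGraph.concat]
      omega
    · obtain ⟨i, hi, rfl⟩ := hlt x hx
      have : (i : ℕ) ≠ A.n - 1 := fun h => hi (Fin.ext h)
      rw [val_leftEmb]
      omega
  unfold LGraph.EPosNC at hA ⊢
  rw [isEPosNCAt_iff_posClass] at hA ⊢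
  have hY : YG (A.concat H).G = pull (leftEmb hq) (YG A.G) * pull (rightEmb hp) (YG H.G) :=
    YG_concatG hp hq A.G H.G
  rw [hY]
  refine PosClass.map ((LinearMap.mulRight ℚ (pull (rightEmb hp) (YG H.G))).comp
    (pull (leftEmb hq))) (fun f hf => ?_) hpos' hA
  refine pull_mul_mem_Ksub (v := A.last) (leftEmb hq) (rightEmb hp) (fun j i hji => ?_) ?_ _
    (fun π => mem_eSpan_of_posClass (hpos' π)) hf
  · have := congrArg Fin.val hji
    rw [val_leftEmb, val_rightEmb] at this
    refine Fin.ext ?_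
    simp only [LGraph.last]
    omega
  · refine ⟨H.last, Fin.ext ?_⟩
    rw [val_rightEmb]
    simp only [LGraph.last, LGraph.concat]
    omega

/-- A clique `X` together with a vertex `z` adjacent to the vertices in `S ⊆ X`. -/
lemma YG_eq_injInd_mul {m : ℕ} {G : SimpleGraph (Fin m)} {X S : Finset (Fin m)} {z : Fin m}
    (hz : z ∉ X) (hS : S ⊆ X)
    (hG : ∀ i j, G.Adj i j ↔ i ≠ j ∧ (i ∈ X ∧ j ∈ X ∨ i = z ∧ j ∈ S ∨ i ∈ S ∧ j = z)) :
    YG G = injInd X * (1 - ∑ s ∈ S, eqInd z s) := by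
  have hXS : injInd X * injInd S = injInd X := by
    funext w
    simp only [injInd, Pi.mul_apply]
    by_cases h : Set.InjOn w X
    · simp [h, h.mono (Finset.coe_subset.2 hS)]
    · simp [h]
  rw [← hXS, mul_assoc, ← injInd_insert fun h => hz (hS h)]
  funext w
  simp only [YG, injInd, Pi.mul_apply]
  rw [ite_zero_mul_ite_zero, mul_one]
  congr 1
  rw [eq_iff_iff]
  constructor
  · intro h
    refine ⟨fun i hi j hj hij => ?_, fun i hi j hj hij => ?_⟩ <;>
    · by_contra hne
      refine h i j ((hG i j).2 ⟨hne, ?_⟩) hij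
      simp only [Finset.coe_insert, Set.mem_insert_iff, Finset.mem_coe] at hi hj
      grind
  · rintro ⟨h1, h2⟩ i j hij hw
    obtain ⟨hne, h⟩ := (hG i j).1 hij
    rcases h with ⟨hi, hj⟩ | ⟨hi, hj⟩ | ⟨hi, hj⟩
    · exact hne (h1 hi hj hw)
    · exact hne (h2 (by simp [hi]) (by simp [hj]) hw)
    · exact hne (h2 (by simp [hi]) (by simp [hj]) hw)

lemma pull_injInd_mul_one_sub_sum {m N : ℕ} (κ : Fin m ↪ Fin N) (X S : Finset (Fin m))
    (z : Fin m) : pull κ (injInd X * (1 - ∑ s ∈ S, eqInd z s)) =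
      injInd (X.map κ) * (1 - ∑ s ∈ S.map κ, eqInd (κ z) s) := by
  rw [pull_mul, pull_injInd, map_sub, map_sum, Finset.sum_map]
  rfl

lemma YG_ICgraph (n k : ℕ) : YG (ICgraph n k) =
    injInd (Finset.univ.filter fun i => (i : ℕ) < n) *
      (1 - ∑ s ∈ Finset.univ.filter (fun i : Fin (n + 1) => k ≤ i ∧ (i : ℕ) < n),
        eqInd (Fin.last n) s) := by
  refine YG_eq_injInd_mul (by simp) (fun i => by simp) fun i j => ?_
  simp only [ICgraph, SimpleGraph.deleteEdges_adj, SimpleGraph.top_adj, Set.mem_ofPred_eq,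
    Sym2.eq_iff, Finset.mem_filter, Finset.mem_univ, true_and, Fin.ext_iff, Fin.val_last, ne_eq]
  refine and_congr_right fun hij => ?_
  constructor
  · intro h
    have h1 : ¬ ((i : ℕ) < k ∧ (j : ℕ) = n) := fun hh => h ⟨i, hh.1, Or.inl ⟨rfl, hh.2⟩⟩
    have h2 : ¬ ((j : ℕ) < k ∧ (i : ℕ) = n) := fun hh => h ⟨j, hh.1, Or.inr ⟨hh.2, rfl⟩⟩
    omega
  · rintro h ⟨t, ht, h'⟩
    omega

lemma YG_revG_ICgraph (n k : ℕ) : YG (revG (ICgraph n k)) =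
    injInd (Finset.univ.filter fun i => 0 < (i : ℕ)) *
      (1 - ∑ s ∈ Finset.univ.filter (fun i : Fin (n + 1) => 0 < (i : ℕ) ∧ i + k ≤ n),
        eqInd 0 s) := by
  refine YG_eq_injInd_mul (by simp) (fun i => by simp +contextual) fun i j => ?_
  simp only [revG, ICgraph, SimpleGraph.comap_adj, SimpleGraph.deleteEdges_adj,
    SimpleGraph.top_adj, Set.mem_ofPred_eq, Sym2.eq_iff, Finset.mem_filter, Finset.mem_univ,
    true_and, Fin.ext_iff, Fin.val_last, ne_eq, Fin.val_zero]
  constructor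
  · rintro ⟨hij, h⟩
    have h1 : ¬ (n - (i : ℕ) < k ∧ n - (j : ℕ) = n) := fun hh =>
      h ⟨⟨n - i, by omega⟩, hh.1, Or.inl ⟨by simp, by simpa using hh.2⟩⟩
    have h2 : ¬ (n - (j : ℕ) < k ∧ n - (i : ℕ) = n) := fun hh =>
      h ⟨⟨n - j, by omega⟩, hh.1, Or.inr ⟨by simpa using hh.2, by simp⟩⟩
    omega
  · rintro ⟨hij, h⟩
    refine ⟨by omega, ?_⟩
    rintro ⟨t, ht, h'⟩
    omega

end Append

theorem stmt6 (n k : ℕ) (hn : 2 ≤ n) (hk1 : 1 ≤ k) (hk2 : k ≤ n) :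
    (LGraph.mk (n + 1) (by omega) (ICgraph n k)).Appendable ∧
    (LGraph.mk (n + 1) (by omega) (revG (ICgraph n k))).Appendable := by
  have hsep : ∀ (p : ℕ) (hp : 0 < p) (a v : Fin (p + (n + 1) - 1))
      (U B : Finset (Fin (p + (n + 1) - 1))), (a : ℕ) = p + (n + 1) - 2 → (v : ℕ) = p - 1 →
      Disjoint U (insert v B) → v ∉ B → (∀ x ∈ U ∪ B, (x : ℕ) < p - 1) →
      Separated U a v B ((Finset.univ.filter fun i : Fin (n + 1) =>
        0 < (i : ℕ) ∧ (i : ℕ) < n).map (rightEmb hp)) := by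
    intro p hp a v U B ha hv hU hB hlt
    rw [Finset.disjoint_left] at hU
    have hC : ∀ y ∈ (Finset.univ.filter fun i : Fin (n + 1) =>
        0 < (i : ℕ) ∧ (i : ℕ) < n).map (rightEmb hp), p - 1 < (y : ℕ) ∧ (y : ℕ) < a := by
      intro y hy
      obtain ⟨i, hi, rfl⟩ := Finset.mem_map.1 hy
      simp only [Finset.mem_filter, Finset.mem_univ, true_and] at hi
      rw [val_rightEmb]
      omega
    refine ⟨fun h => ?_, fun h => hU h (Finset.mem_insert_self _ _), fun h => ?_, fun y hy => ?_,
      fun y hy => ?_⟩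
    · have := hlt a (Finset.mem_union_left _ h)
      omega
    · have := congrArg Fin.val h
      omega
    · have := hlt y (Finset.mem_union_right _ hy)
      refine ⟨fun h => hU h (Finset.mem_insert_of_mem hy), ?_, ?_⟩ <;>
      · rintro rfl
        omega
    · have := hC y hy
      refine ⟨fun h => ?_, ?_, ?_, fun h => ?_⟩
      · have := hlt y (Finset.mem_union_left _ h)
        omega
      · rintro rfl
        omega
      · rintro rfl
        omega
      · have := hlt y (Finset.mem_union_right _ h)
        omega
  have hne : ∀ (p : ℕ) (hp : 0 < p), ((Finset.univ.filter fun i : Fin (n + 1) =>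
      0 < (i : ℕ) ∧ (i : ℕ) < n).map (rightEmb hp)).Nonempty := fun p hp =>
    Finset.Nonempty.map ⟨⟨1, by omega⟩, Finset.mem_filter.2 ⟨Finset.mem_univ _, Nat.one_pos, hn⟩⟩
  refine ⟨LGraph.appendable_of_posClass _ ?_, LGraph.appendable_of_posClass _ ?_⟩ <;>
    intro p hp a v U B r ha hv hr hU hB hlt <;> dsimp only at *
  · have hclique : (Finset.univ.filter fun i : Fin (n + 1) => (i : ℕ) < n).map (rightEmb hp) =
        insert v ((Finset.univ.filter fun i : Fin (n + 1) =>
          0 < (i : ℕ) ∧ (i : ℕ) < n).map (rightEmb hp)) := by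
      have : v = rightEmb hp 0 := Fin.ext (by rw [val_rightEmb, hv]; simp)
      rw [this, ← Finset.map_insert]
      congr 1
      ext i
      simp only [Finset.mem_filter, Finset.mem_univ, true_and, Finset.mem_insert, Fin.ext_iff,
        Fin.val_zero]
      omega
    have hlast : rightEmb hp (Fin.last n) = a :=
      Fin.ext (by rw [val_rightEmb, ha, Fin.val_last]; omega)
    rw [YG_ICgraph, pull_injInd_mul_one_sub_sum, hclique, hlast]
    refine posClass_append_iceCream hr (hsep p hp a v U B ha hv hU hB hlt)
      (Finset.map_subset_map.2 fun i => ?_) (hne p hp)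
    simp only [Finset.mem_filter, Finset.mem_univ, true_and]
    omega
  · have hclique : (Finset.univ.filter fun i : Fin (n + 1) => 0 < (i : ℕ)).map (rightEmb hp) =
        insert a ((Finset.univ.filter fun i : Fin (n + 1) =>
          0 < (i : ℕ) ∧ (i : ℕ) < n).map (rightEmb hp)) := by
      have : a = rightEmb hp (Fin.last n) :=
        Fin.ext (by rw [val_rightEmb, ha, Fin.val_last]; omega)
      rw [this, ← Finset.map_insert]
      congr 1
      ext i
      simp only [Finset.mem_filter, Finset.mem_univ, true_and, Finset.mem_insert, Fin.ext_iff,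
        Fin.val_last]
      omega
    have hfirst : rightEmb hp (0 : Fin (n + 1)) = v :=
      Fin.ext (by rw [val_rightEmb, hv]; simp)
    rw [YG_revG_ICgraph, pull_injInd_mul_one_sub_sum, hclique, hfirst]
    refine posClass_append_reverse hr (hsep p hp a v U B ha hv hU hB hlt)
      (Finset.map_subset_map.2 fun i => ?_) (hne p hp)
    simp only [Finset.mem_filter, Finset.mem_univ, true_and]
    omega
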